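/- When real quadratic fields are ordered by discriminant, a density of 100% of them satisfy Cl(F) ≠ Cl⁺(F); that is, lim_{X→∞} #{real quadratic F : Disc(F)<X, |Cl⁺(F)| = |Cl(F)|} / #{real quadratic F : Disc(F)<X} = 0. -/

import Mathlib

open NumberField Filter Topology
open scoped nonZeroDivisors Classical

noncomputable section

/-- The setoid of subfields of `ℂ` (finite over `ℚ` or not), up to `ℚ`-algebra isomorphism. -/
def isoSetoid : Setoid (IntermediateField ℚ ℂ) where
  r K L := Nonempty (↥K ≃ₐ[ℚ] ↥L)
  iseqv := ⟨fun _ => ⟨AlgEquiv.refl⟩, fun ⟨e⟩ => ⟨e.symm⟩, fun ⟨e⟩ ⟨f⟩ => ⟨e.trans f⟩⟩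

/-- Isomorphism classes of subfields of `ℂ`; since every number field embeds into `ℂ`,
every isomorphism class of number fields is represented here. -/
abbrev FieldClass : Type := Quotient isoSetoid

/-- `K` is a cubic field. -/
def IsCubic (K : IntermediateField ℚ ℂ) : Prop := Module.finrank ℚ ↥K = 3

/-- `K` (cubic) is totally real: it has three real embeddings. -/
def IsTotallyRealCubic (K : IntermediateField ℚ ℂ) : Prop :=
  Module.finrank ℚ ↥K = 3 ∧ Nat.card (↥K →+* ℝ) = 3

/-- `K` is a complex cubic field: cubic with exactly one real embedding. -/
def IsComplexCubic (K : IntermediateField ℚ ℂ) : Prop :=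
  Module.finrank ℚ ↥K = 3 ∧ Nat.card (↥K →+* ℝ) = 1

/-- `K` is a real quadratic field. -/
def IsRealQuadratic (K : IntermediateField ℚ ℂ) : Prop :=
  Module.finrank ℚ ↥K = 2 ∧ Nat.card (↥K →+* ℝ) = 2

/-- The discriminant of a subfield of `ℂ` that is a number field (junk value `0` otherwise). -/
def intDisc (K : IntermediateField ℚ ℂ) : ℤ :=
  letI : CharZero ↥K := charZero_of_injective_algebraMap (algebraMap ℚ ↥K).injective
  if h : FiniteDimensional ℚ ↥K then
    letI := h
    letI : NumberField ↥K := ⟨⟩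
    NumberField.discr ↥K
  else 0

/-- The absolute value of the discriminant. -/
def absDisc (K : IntermediateField ℚ ℂ) : ℕ := (intDisc K).natAbs

/-- The class number `|Cl(K)|`. -/
def clCard (K : IntermediateField ℚ ℂ) : ℕ := Nat.card (ClassGroup (𝓞 ↥K))

/-- The number of 2-torsion elements of the class group. -/
def cl2Card (K : IntermediateField ℚ ℂ) : ℕ :=
  Nat.card {c : ClassGroup (𝓞 ↥K) // c ^ 2 = 1}

/-- The narrow class group of a number field `K`: the quotient of the group of invertible
fractional ideals of `𝓞 K` by the subgroup generated by principal fractional ideals with a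
totally positive generator. -/
abbrev narrowClassGroup (K : Type*) [Field K] [NumberField K] : Type _ :=
  (FractionalIdeal (𝓞 K)⁰ K)ˣ ⧸
    Subgroup.closure {I : (FractionalIdeal (𝓞 K)⁰ K)ˣ |
      ∃ x : Kˣ, (∀ σ : K →+* ℝ, 0 < σ (x : K)) ∧ toPrincipalIdeal (𝓞 K) K x = I}

/-- The cardinality of the narrow class group (junk value `0` if not a number field). -/
def clPlusCard (K : IntermediateField ℚ ℂ) : ℕ :=
  letI : CharZero ↥K := charZero_of_injective_algebraMap (algebraMap ℚ ↥K).injective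
  if h : FiniteDimensional ℚ ↥K then
    letI := h
    letI : NumberField ↥K := ⟨⟩
    Nat.card (narrowClassGroup ↥K)
  else 0

/-- The number of 2-torsion elements of the narrow class group. -/
def cl2PlusCard (K : IntermediateField ℚ ℂ) : ℕ :=
  letI : CharZero ↥K := charZero_of_injective_algebraMap (algebraMap ℚ ↥K).injective
  if h : FiniteDimensional ℚ ↥K then
    letI := h
    letI : NumberField ↥K := ⟨⟩
    Nat.card {c : narrowClassGroup ↥K // c ^ 2 = 1}
  else 0

/-- The number of isomorphism classes of number fields (as subfields of `ℂ`) satisfying an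
isomorphism-invariant predicate `P`. -/
def classCount (P : IntermediateField ℚ ℂ → Prop) : ℕ :=
  Nat.card {c : FieldClass // P c.out}

end

/-- The sum of the reciprocals of the primes in an invertible residue class diverges. -/
theorem not_summable_inv_prime_residueClass {q : ℕ} [NeZero q] {a : ZMod q} (ha : IsUnit a) :
    ¬ Summable (fun n : ℕ => if n.Prime ∧ (n : ZMod q) = a then (n : ℝ)⁻¹ else 0) := by
  intro H
  set R := ArithmeticFunction.vonMangoldt.residueClass a with hR
  have hR0 : ∀ n, 0 ≤ R n := ArithmeticFunction.vonMangoldt.residueClass_nonneg a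
  have hsum := H.add (ArithmeticFunction.vonMangoldt.summable_residueClass_non_primes_div a)
  have hbound : ∀ x : ℝ, x ∈ Set.Ioc (1 : ℝ) 2 → ∀ n : ℕ,
      ‖(x - 1) * (R n / (n : ℝ) ^ x)‖ ≤
        (if n.Prime ∧ (n : ZMod q) = a then (n : ℝ)⁻¹ else 0) +
          (if n.Prime then 0 else R n) / n := by
    rintro x ⟨hx1, hx2⟩ n
    have hx0 : 0 < x - 1 := by linarith
    rw [Real.norm_of_nonneg (by have := hR0 n; positivity)]
    rcases Nat.eq_zero_or_pos n with rfl | hn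
    · simp [hR]
    have hn' : (0 : ℝ) < n := by exact_mod_cast hn
    have hn1 : (1 : ℝ) ≤ n := by exact_mod_cast hn
    have hpow : (n : ℝ) ^ x = n * Real.exp ((x - 1) * Real.log n) := by
      rw [Real.rpow_def_of_pos hn']
      nth_rw 2 [← Real.exp_log hn']
      rw [← Real.exp_add]; ring_nf
    have hexp := Real.add_one_le_exp ((x - 1) * Real.log n)
    have hlog : 0 ≤ Real.log n := Real.log_nonneg hn1
    by_cases hp : n.Prime
    · by_cases hna : (n : ZMod q) = a
      · have : R n = Real.log n := by
          simp [hR, hna, ArithmeticFunction.vonMangoldt_apply_prime hp]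
        simp only [hp, hna, and_self, if_true, zero_div, add_zero, this, hpow]
        rw [mul_div_assoc', div_le_iff₀ (by positivity), ← mul_assoc,
          inv_mul_cancel₀ hn'.ne', one_mul]
        linarith
      · have : R n = 0 := by simp [hR, hna]
        simp [this, hp, hna]
    · simp only [hp, false_and, if_false, zero_add, hpow]
      rw [mul_div_assoc', div_le_div_iff₀ (by positivity) hn']
      have h1 : (x - 1) ≤ Real.exp ((x - 1) * Real.log n) := by nlinarith
      have := mul_le_mul_of_nonneg_left h1 (mul_nonneg (hR0 n) hn'.le)
      nlinarith
  have hmem : ∀ᶠ x : ℝ in 𝓝[>] 1, x ∈ Set.Ioc (1 : ℝ) 2 := Ioc_mem_nhdsGT (by norm_num)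
  have hlim : Tendsto (fun x : ℝ => ∑' n : ℕ, (x - 1) * (R n / (n : ℝ) ^ x)) (𝓝[>] 1)
      (𝓝 (∑' _ : ℕ, (0 : ℝ))) := by
    refine tendsto_tsum_of_dominated_convergence hsum (fun n => ?_) ?_
    · have : Tendsto (fun x : ℝ => (x - 1) * (R n / (n : ℝ) ^ x)) (𝓝 1)
          (𝓝 ((1 - 1) * (R n / (n : ℝ) ^ (1 : ℝ)))) := by
        rcases Nat.eq_zero_or_pos n with rfl | hn
        · simp [hR]
        have hn' : (n : ℝ) ≠ 0 := by exact_mod_cast hn.ne'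
        refine Tendsto.mul (tendsto_id.sub_const 1) (tendsto_const_nhds.div ?_ ?_)
        · exact (Real.continuous_const_rpow hn').tendsto 1
        · simpa using hn'
      simpa using this.mono_left nhdsWithin_le_nhds
    · filter_upwards [hmem] with x hx n using hbound x hx n
  obtain ⟨C, hC⟩ := ArithmeticFunction.vonMangoldt.LSeries_residueClass_lower_bound ha
  have hlow : Tendsto (fun x : ℝ => (q.totient : ℝ)⁻¹ - (x - 1) * C) (𝓝[>] 1)
      (𝓝 ((q.totient : ℝ)⁻¹ - (1 - 1) * C)) :=
    (Continuous.tendsto (by fun_prop) 1).mono_left nhdsWithin_le_nhds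
  have hle := le_of_tendsto_of_tendsto hlow hlim (by
    filter_upwards [hmem] with x hx
    have hx0 : 0 < x - 1 := by linarith [hx.1]
    have := mul_le_mul_of_nonneg_left (hC hx) hx0.le
    rw [tsum_mul_left]
    refine le_trans (le_of_eq ?_) this
    field_simp)
  have hq : 0 < (q.totient : ℝ)⁻¹ := inv_pos.mpr (mod_cast q.totient.pos_of_neZero)
  rw [tsum_zero, sub_self, zero_mul, sub_zero] at hle
  linarith

/-- There are products of primes congruent to `3` modulo `4` with arbitrarily small `φ(P) / P`. -/
theorem exists_totient_le_mul {ε : ℝ} (hε : 0 < ε) : ∃ P : ℕ, P ≠ 0 ∧ (P.totient : ℝ) ≤ ε * P ∧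
    ∀ n : ℕ, (∀ p : ℕ, p.Prime → p % 4 = 3 → ¬ p ∣ n) → P.Coprime n := by
  have hdiv := not_summable_inv_prime_residueClass (q := 4) (a := 3) (by decide)
  rw [not_summable_iff_tendsto_nat_atTop_of_nonneg (fun n => by positivity)] at hdiv
  obtain ⟨N, hN⟩ := (hdiv.eventually_ge_atTop (-Real.log ε)).exists
  rw [← Finset.sum_filter] at hN
  set S := (Finset.range N).filter (fun n : ℕ => n.Prime ∧ (n : ZMod 4) = 3) with hS
  have hSp : ∀ p ∈ S, p.Prime := fun p hp => (Finset.mem_filter.1 hp).2.1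
  have hP0 : ∏ p ∈ S, p ≠ 0 := Finset.prod_ne_zero_iff.2 fun p hp => (hSp p hp).ne_zero
  refine ⟨∏ p ∈ S, p, hP0, ?_, fun n hn => ?_⟩
  · have hfac : (∏ p ∈ S, p).primeFactors = S := Nat.primeFactors_prod hSp
    have h := Nat.totient_eq_mul_prod_factors (∏ p ∈ S, p)
    rw [hfac] at h
    have h' : ((∏ p ∈ S, p).totient : ℝ) =
        ((∏ p ∈ S, p : ℕ) : ℝ) * ∏ p ∈ S, (1 - (p : ℝ)⁻¹) := by
      have := congrArg (fun x : ℚ => (x : ℝ)) h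
      push_cast at this
      push_cast
      exact this
    rw [h', mul_comm]
    refine mul_le_mul_of_nonneg_right ?_ (Nat.cast_nonneg _)
    calc ∏ p ∈ S, (1 - (p : ℝ)⁻¹) ≤ ∏ p ∈ S, Real.exp (-(p : ℝ)⁻¹) := by
          refine Finset.prod_le_prod (fun p hp => ?_) (fun p _ => ?_)
          · have : (1 : ℝ) ≤ p := by exact_mod_cast (hSp p hp).one_lt.le
            linarith [inv_le_one_of_one_le₀ this]
          · linarith [Real.add_one_le_exp (-(p : ℝ)⁻¹)]
      _ = Real.exp (-∑ p ∈ S, (p : ℝ)⁻¹) := by rw [← Real.exp_sum, Finset.sum_neg_distrib]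
      _ ≤ Real.exp (Real.log ε) := Real.exp_le_exp.2 (by linarith)
      _ = ε := Real.exp_log hε
  · refine Nat.Coprime.prod_left fun p hp => ((hSp p hp).coprime_iff_not_dvd).2 (hn p (hSp p hp) ?_)
    have h3 : ((p : ℕ) : ZMod 4) = ((3 : ℕ) : ZMod 4) := (Finset.mem_filter.1 hp).2.2
    rw [ZMod.natCast_eq_natCast_iff'] at h3
    exact h3

theorem sum_inv_sq_Icc_two_le (N : ℕ) : ∑ k ∈ Finset.Icc 2 N, ((k : ℝ) ^ 2)⁻¹ ≤ 3 / 4 := by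
  have key : ∀ N : ℕ, 2 ≤ N → ∑ k ∈ Finset.Icc 2 N, ((k : ℝ) ^ 2)⁻¹ ≤ 3 / 4 - (N : ℝ)⁻¹ := by
    intro N hN
    induction N, hN using Nat.le_induction with
    | base => norm_num
    | succ n hn ih =>
      rw [Finset.sum_Icc_succ_top (by omega)]
      have hn' : (0 : ℝ) < n := by positivity
      have : (((n + 1 : ℕ) : ℝ) ^ 2)⁻¹ ≤ (n : ℝ)⁻¹ - ((n + 1 : ℕ) : ℝ)⁻¹ := by
        push_cast
        rw [inv_sub_inv (by positivity) (by positivity), inv_eq_one_div,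
          div_le_div_iff₀ (by positivity) (by positivity)]
        nlinarith
      linarith
  rcases le_or_gt 2 N with h | h
  · have := key N h
    have h2 : (0 : ℝ) ≤ (N : ℝ)⁻¹ := by positivity
    linarith
  · rw [Finset.Icc_eq_empty (by omega)]; norm_num

/-- At least a quarter of the positive integers up to `N` are squarefree. -/
theorem le_four_mul_card_squarefree (N : ℕ) :
    (N : ℝ) ≤ 4 * ((Finset.Ioc 0 N).filter Squarefree).card := by
  have hsub : (Finset.Ioc 0 N).filter (fun n => ¬ Squarefree n) ⊆
      (Finset.Icc 2 N).biUnion fun k => (Finset.Ioc 0 N).filter (k ^ 2 ∣ ·) := by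
    intro n hn
    simp only [Finset.mem_filter, Finset.mem_Ioc] at hn
    obtain ⟨⟨hn0, hnN⟩, hsq⟩ := hn
    rw [Nat.squarefree_iff_prime_squarefree] at hsq
    push Not at hsq
    obtain ⟨p, hp, hpn⟩ := hsq
    simp only [Finset.mem_biUnion, Finset.mem_Icc, Finset.mem_filter, Finset.mem_Ioc]
    refine ⟨p, ⟨hp.two_le, ?_⟩, ⟨hn0, hnN⟩, by rwa [sq]⟩
    exact (Nat.le_of_dvd hn0 (dvd_of_mul_left_dvd hpn)).trans hnN
  have h1 : (((Finset.Ioc 0 N).filter (fun n => ¬ Squarefree n)).card : ℝ) ≤ N * (3 / 4) :=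
    calc (((Finset.Ioc 0 N).filter (fun n => ¬ Squarefree n)).card : ℝ)
        ≤ ((∑ k ∈ Finset.Icc 2 N, ((Finset.Ioc 0 N).filter (k ^ 2 ∣ ·)).card : ℕ) : ℝ) := by
          exact_mod_cast (Finset.card_le_card hsub).trans Finset.card_biUnion_le
      _ ≤ ∑ k ∈ Finset.Icc 2 N, (N : ℝ) * ((k : ℝ) ^ 2)⁻¹ := by
          push_cast
          refine Finset.sum_le_sum fun k _ => ?_
          rw [Nat.Ioc_filter_dvd_card_eq_div, ← div_eq_mul_inv]
          exact_mod_cast Nat.cast_div_le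
      _ ≤ N * (3 / 4) := by
          rw [← Finset.mul_sum]
          exact mul_le_mul_of_nonneg_left (sum_inv_sq_Icc_two_le N) (Nat.cast_nonneg _)
  have h2 := Finset.card_filter_add_card_filter_not (s := Finset.Ioc 0 N) Squarefree
  rw [Nat.card_Ioc] at h2
  have h3 : ((((Finset.Ioc 0 N).filter Squarefree).card : ℝ) +
    ((Finset.Ioc 0 N).filter (fun n => ¬ Squarefree n)).card) = N := by exact_mod_cast h2
  linarith

section QuadraticNumberField

open scoped Matrix

variable {K : Type*} [Field K] [NumberField K]

/-- An integer of a quadratic field is a root of `X ^ 2 - t X + n`, with `t` its trace and `n` its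
norm. -/
theorem sq_eq_trace_mul_sub_norm (hK : Module.finrank ℚ K = 2) (x : 𝓞 K) :
    x ^ 2 = (Algebra.trace ℤ (𝓞 K) x : 𝓞 K) * x - (Algebra.norm ℤ x : 𝓞 K) := by
  let b : Module.Basis (Fin 2) ℤ (𝓞 K) :=
    Module.finBasisOfFinrankEq ℤ (𝓞 K) (by rw [RingOfIntegers.rank, hK])
  apply Algebra.leftMulMatrix_injective b
  rw [Algebra.trace_eq_matrix_trace b, Algebra.norm_eq_matrix_det b, map_pow, map_sub, map_mul,
    map_intCast, map_intCast]
  generalize Algebra.leftMulMatrix b x = M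
  rw [Matrix.trace_fin_two, Matrix.det_fin_two, sq]
  ext i j
  rw [Matrix.sub_apply, Matrix.mul_apply, Matrix.mul_apply, Fin.sum_univ_two, Fin.sum_univ_two]
  fin_cases i <;> fin_cases j <;> simp [Matrix.intCast_apply] <;> ring

/-- The discriminant of the minimal polynomial of an integer of a quadratic field differs from the
discriminant of the field by a square factor. -/
theorem exists_trace_sq_sub_four_mul_norm (hK : Module.finrank ℚ K = 2) (x : 𝓞 K) :
    ∃ m : ℤ, Algebra.trace ℤ (𝓞 K) x ^ 2 - 4 * Algebra.norm ℤ x = m ^ 2 * discr K := by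
  let b : Module.Basis (Fin 2) ℤ (𝓞 K) :=
    Module.finBasisOfFinrankEq ℤ (𝓞 K) (by rw [RingOfIntegers.rank, hK])
  let P : Matrix (Fin 2) (Fin 2) ℤ := Matrix.of fun i j => b.repr (![1, x] i) j
  refine ⟨P.det, ?_⟩
  have hP : P.map (algebraMap ℤ (𝓞 K)) *ᵥ b = ![1, x] := by
    ext i
    have := b.sum_repr (![1, x] i)
    rw [← this]
    simp [P, Matrix.mulVec, dotProduct, Algebra.smul_def]
  have htr1 : Algebra.trace ℤ (𝓞 K) 1 = 2 := by
    have := Algebra.trace_algebraMap_of_basis b (1 : ℤ)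
    simpa using this
  have htr2 : Algebra.trace ℤ (𝓞 K) (x * x) =
      Algebra.trace ℤ (𝓞 K) x ^ 2 - 2 * Algebra.norm ℤ x := by
    rw [← sq, sq_eq_trace_mul_sub_norm hK x, map_sub, ← zsmul_eq_mul, map_zsmul,
      ← mul_one ((Algebra.norm ℤ x : ℤ) : 𝓞 K), ← zsmul_eq_mul, map_zsmul, htr1]
    simp only [smul_eq_mul]; ring
  rw [← discr_eq_discr K b, ← Algebra.discr_of_matrix_mulVec, hP, Algebra.discr_def,
    Matrix.det_fin_two]
  simp [Algebra.traceMatrix_apply, Algebra.traceForm_apply, htr1, htr2]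
  ring

theorem exists_sub_trace_sq (hK : Module.finrank ℚ K = 2) (x : 𝓞 K) :
    ∃ m : ℤ, (2 * (x : K) - (Algebra.trace ℤ (𝓞 K) x : K)) ^ 2 = (m : K) ^ 2 * (discr K : K) := by
  obtain ⟨m, hm⟩ := exists_trace_sq_sub_four_mul_norm hK x
  refine ⟨m, ?_⟩
  have h1 := congrArg (algebraMap (𝓞 K) K) (sq_eq_trace_mul_sub_norm hK x)
  have h2 := congrArg (Int.cast : ℤ → K) hm
  simp only [map_pow, map_sub, map_mul, map_intCast] at h1
  push_cast at h2
  linear_combination 4 * h1 + h2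

theorem exists_not_mem_range_of_finrank_eq_two (hK : Module.finrank ℚ K = 2) :
    ∃ x : 𝓞 K, ∀ q : ℚ, (x : K) ≠ q := by
  by_contra! h
  have htop : (⊥ : Subalgebra ℚ K) = ⊤ := by
    refine eq_top_iff.2 fun y _ => ?_
    obtain ⟨a, b, -, rfl⟩ := IsFractionRing.div_surjective (A := 𝓞 K) y
    obtain ⟨q, hq⟩ := h a
    obtain ⟨r, hr⟩ := h b
    exact Algebra.mem_bot.2 ⟨q / r, by simp [hq, hr]⟩
  rw [Subalgebra.bot_eq_top_iff_finrank_eq_one, hK] at htop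
  omega

/-- A quadratic field is generated by a square root of its discriminant. -/
theorem exists_sq_eq_discr (hK : Module.finrank ℚ K = 2) :
    ∃ δ : K, δ ^ 2 = discr K ∧ ∀ z : K, ∃ a b : ℚ, z = a + b * δ := by
  obtain ⟨x, hx⟩ := exists_not_mem_range_of_finrank_eq_two hK
  obtain ⟨m, hm⟩ := exists_sub_trace_sq hK x
  have hm0 : (m : K) ≠ 0 := by
    intro h
    rw [h, zero_pow two_ne_zero, zero_mul, sq_eq_zero_iff, sub_eq_zero] at hm
    refine hx ((Algebra.trace ℤ (𝓞 K) x : ℚ) / 2) ?_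
    push_cast
    rw [← hm]; field_simp
  set δ : K := (2 * (x : K) - (Algebra.trace ℤ (𝓞 K) x : K)) / m with hδ
  have hδ2 : δ ^ 2 = discr K := by
    rw [hδ, div_pow, hm]; field_simp
  refine ⟨δ, hδ2, ?_⟩
  have hint : ∀ y : 𝓞 K, ∃ a b : ℚ, (y : K) = a + b * δ := by
    intro y
    obtain ⟨k, hk⟩ := exists_sub_trace_sq hK y
    rw [← hδ2, ← mul_pow, sq_eq_sq_iff_eq_or_eq_neg] at hk
    rcases hk with hk | hk
    · refine ⟨(Algebra.trace ℤ (𝓞 K) y : ℚ) / 2, (k : ℚ) / 2, ?_⟩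
      push_cast
      linear_combination hk / 2
    · refine ⟨(Algebra.trace ℤ (𝓞 K) y : ℚ) / 2, -(k : ℚ) / 2, ?_⟩
      push_cast
      linear_combination hk / 2
  intro z
  obtain ⟨n, hn, hz⟩ := ((IsFractionRing.isAlgebraic_iff ℤ ℚ K).2
    (Algebra.IsAlgebraic.isAlgebraic (R := ℚ) z)).exists_integral_multiple
  obtain ⟨a, b, hab⟩ := hint ⟨n • z, hz⟩
  have hn' : (n : K) ≠ 0 := by exact_mod_cast hn
  refine ⟨a / n, b / n, ?_⟩
  change n • z = a + b * δ at hab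
  rw [zsmul_eq_mul] at hab
  push_cast
  field_simp
  linear_combination hab

theorem map_eq_neg_of_ne {δ : K} (hδ : δ ^ 2 = discr K)
    (hspan : ∀ z : K, ∃ a b : ℚ, z = a + b * δ) {ρ₁ ρ₂ : K →+* ℝ} (hρ : ρ₁ ≠ ρ₂) :
    ρ₂ δ = - ρ₁ δ := by
  have h : ρ₂ δ ^ 2 = ρ₁ δ ^ 2 := by
    rw [← map_pow, ← map_pow, hδ, map_intCast, map_intCast]
  rcases sq_eq_sq_iff_eq_or_eq_neg.1 h with h | h
  · refine absurd ?_ hρ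
    ext z
    obtain ⟨a, b, rfl⟩ := hspan z
    simp [h]
  · exact h

theorem discr_pos_of_realEmbedding (hK : Module.finrank ℚ K = 2) (ρ : K →+* ℝ) :
    0 < discr K := by
  obtain ⟨δ, hδ, -⟩ := exists_sq_eq_discr hK
  have h : ((discr K : ℤ) : ℝ) = ρ δ ^ 2 := by rw [← map_pow, hδ, map_intCast]
  have h0 : (0 : ℝ) ≤ (discr K : ℤ) := h ▸ sq_nonneg _
  exact lt_of_le_of_ne (by exact_mod_cast h0) (discr_ne_zero K).symm

/-- The principal ideals with a totally positive generator already form a subgroup. -/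
theorem exists_totallyPositive_of_mem_closure {I : (FractionalIdeal (𝓞 K)⁰ K)ˣ}
    (hI : I ∈ Subgroup.closure {I : (FractionalIdeal (𝓞 K)⁰ K)ˣ |
      ∃ x : Kˣ, (∀ σ : K →+* ℝ, 0 < σ (x : K)) ∧ toPrincipalIdeal (𝓞 K) K x = I}) :
    ∃ x : Kˣ, (∀ σ : K →+* ℝ, 0 < σ (x : K)) ∧ toPrincipalIdeal (𝓞 K) K x = I := by
  induction hI using Subgroup.closure_induction with
  | mem I h => exact h
  | one => exact ⟨1, by simp, map_one _⟩
  | mul I J _ _ hI hJ =>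
    obtain ⟨x, hx, rfl⟩ := hI
    obtain ⟨y, hy, rfl⟩ := hJ
    exact ⟨x * y, fun σ => by simpa using mul_pos (hx σ) (hy σ), map_mul _ _ _⟩
  | inv I _ hI =>
    obtain ⟨x, hx, rfl⟩ := hI
    exact ⟨x⁻¹, fun σ => by simpa using hx σ, map_inv _ _⟩

/-- If the narrow class group is not larger than the class group, then every nonzero element is
a unit times a totally positive element. -/
theorem exists_unit_mul_totallyPositive
    (h : Nat.card (narrowClassGroup K) = Nat.card (ClassGroup (𝓞 K))) (y : Kˣ) :
    ∃ u : (𝓞 K)ˣ, ∀ σ : K →+* ℝ, 0 < σ ((u : 𝓞 K) * (y : K)) := by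
  set H := Subgroup.closure {I : (FractionalIdeal (𝓞 K)⁰ K)ˣ |
        ∃ x : Kˣ, (∀ σ : K →+* ℝ, 0 < σ (x : K)) ∧ toPrincipalIdeal (𝓞 K) K x = I} with hH
  have hle : H ≤ (toPrincipalIdeal (𝓞 K) K).range := by
    rw [hH, Subgroup.closure_le]
    rintro _ ⟨x, -, rfl⟩
    exact ⟨x, rfl⟩
  have hidx : H.index = (toPrincipalIdeal (𝓞 K) K).range.index := by
    rw [Subgroup.index, h, Nat.card_congr (ClassGroup.equiv K).toEquiv, Subgroup.index]
  have hne : (toPrincipalIdeal (𝓞 K) K).range.index ≠ 0 := by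
    rw [Subgroup.index, ← Nat.card_congr (ClassGroup.equiv (R := 𝓞 K) K).toEquiv]
    exact Nat.card_pos.ne'
  have hrel : H.relIndex (toPrincipalIdeal (𝓞 K) K).range = 1 := by
    have := Subgroup.relIndex_mul_index hle
    rw [hidx] at this
    exact Nat.eq_of_mul_eq_mul_right (Nat.pos_of_ne_zero hne) (by rw [this, one_mul])
  have hmem : toPrincipalIdeal (𝓞 K) K y ∈ H :=
    Subgroup.relIndex_eq_one.1 hrel ⟨y, rfl⟩
  obtain ⟨x, hx, hxy⟩ := exists_totallyPositive_of_mem_closure hmem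
  rw [toPrincipalIdeal_eq_iff, coe_toPrincipalIdeal,
    FractionalIdeal.spanSingleton_eq_spanSingleton] at hxy
  obtain ⟨u, hu⟩ := hxy
  refine ⟨u⁻¹, fun σ => ?_⟩
  have : ((u⁻¹ : (𝓞 K)ˣ) : 𝓞 K) * (y : K) = x := by
    rw [← hu, Units.smul_def, Algebra.smul_def, ← mul_assoc, ← map_mul]
    simp
  rw [this]
  exact hx σ

/-- If the narrow class group of a real quadratic field is not larger than its class group, there
is a unit of norm `-1`. -/
theorem exists_norm_eq_neg_one (hK : Module.finrank ℚ K = 2) (hR : Nat.card (K →+* ℝ) = 2)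
    (h : Nat.card (narrowClassGroup K) = Nat.card (ClassGroup (𝓞 K))) :
    ∃ x : 𝓞 K, Algebra.norm ℤ x = -1 := by
  obtain ⟨δ, hδ, hspan⟩ := exists_sq_eq_discr hK
  have hδ0 : δ ≠ 0 := by
    rintro rfl
    rw [zero_pow two_ne_zero, eq_comm, Int.cast_eq_zero] at hδ
    exact discr_ne_zero K hδ
  obtain ⟨u, hu⟩ := exists_unit_mul_totallyPositive h (Units.mk0 δ hδ0)
  obtain ⟨ρ₁, ρ₂, hρ, -⟩ := Nat.card_eq_two_iff.1 hR
  refine ⟨u, ?_⟩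
  have hneg := map_eq_neg_of_ne hδ hspan hρ
  have hu1 := hu ρ₁
  have hu2 := hu ρ₂
  simp only [Units.val_mk0, map_mul, hneg] at hu1 hu2
  have huu : ρ₁ (u : 𝓞 K) * ρ₂ (u : 𝓞 K) < 0 := by
    have h3 := mul_pos hu1 hu2
    have h4 : 0 < ρ₁ δ ^ 2 := by
      have : ρ₁ δ ≠ 0 := by simpa using hδ0
      positivity
    nlinarith
  have hq := sq_eq_trace_mul_sub_norm hK (u : 𝓞 K)
  have hq1 := congrArg (fun z : 𝓞 K => ρ₁ z) hq
  have hq2 := congrArg (fun z : 𝓞 K => ρ₂ z) hq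
  simp only [map_pow, map_sub, map_mul, map_intCast] at hq1 hq2
  have hne : ρ₁ (u : 𝓞 K) - ρ₂ (u : 𝓞 K) ≠ 0 := by
    intro h0
    rw [sub_eq_zero.1 h0] at huu
    nlinarith [mul_self_nonneg (ρ₂ (u : 𝓞 K))]
  have hn : ((Algebra.norm ℤ (u : 𝓞 K) : ℤ) : ℝ) = ρ₁ (u : 𝓞 K) * ρ₂ (u : 𝓞 K) := by
    apply mul_left_cancel₀ hne
    linear_combination ρ₁ (u : 𝓞 K) * hq2 - ρ₂ (u : 𝓞 K) * hq1
  have hn0 : Algebra.norm ℤ (u : 𝓞 K) < 0 := by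
    rw [← hn] at huu
    exact_mod_cast huu
  rcases Int.isUnit_iff.1 (u.isUnit.map (Algebra.norm ℤ)) with h1 | h1
  · omega
  · exact h1

/-- If the narrow class group of a real quadratic field is not larger than its class group, no
prime congruent to `3` modulo `4` divides the discriminant. -/
theorem not_dvd_discr_of_card_eq (hK : Module.finrank ℚ K = 2) (hR : Nat.card (K →+* ℝ) = 2)
    (h : Nat.card (narrowClassGroup K) = Nat.card (ClassGroup (𝓞 K))) {p : ℕ} (hp : p.Prime) (hp4 : p % 4 = 3) :
    ¬ (p : ℤ) ∣ discr K := by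
  intro hdvd
  obtain ⟨x, hx⟩ := exists_norm_eq_neg_one hK hR h
  obtain ⟨m, hm⟩ := exists_trace_sq_sub_four_mul_norm hK x
  rw [hx] at hm
  have hpt : (p : ℤ) ∣ Algebra.trace ℤ (𝓞 K) x ^ 2 + 4 := by
    have := hdvd.mul_left (m ^ 2)
    rw [← hm] at this
    simpa using this
  have : Fact p.Prime := ⟨hp⟩
  have h2 : (2 : ZMod p) ≠ 0 := by
    intro h2
    have : p ∣ 2 := (ZMod.natCast_eq_zero_iff 2 p).1 (by exact_mod_cast h2)
    have := (Nat.prime_dvd_prime_iff_eq hp Nat.prime_two).1 this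
    omega
  have hz := (ZMod.intCast_zmod_eq_zero_iff_dvd _ p).2 hpt
  push_cast at hz
  refine ZMod.exists_sq_eq_neg_one_iff.1
    ⟨(Algebra.trace ℤ (𝓞 K) x : ZMod p) / 2, ?_⟩ hp4
  field_simp
  linear_combination -hz

/-- The discriminant of a quadratic field containing a square root of a squarefree integer
`d > 1` is `4 * d` up to a square factor. -/
theorem exists_four_mul_eq_sq_mul_discr (hK : Module.finrank ℚ K = 2) {d : ℕ} (hd : Squarefree d)
    (hd1 : 1 < d) {x : K} (hx : x ^ 2 = d) : ∃ m : ℤ, 4 * (d : ℤ) = m ^ 2 * discr K := by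
  have hint : IsIntegral ℤ x := by
    refine IsIntegral.of_pow (n := 2) two_pos ?_
    rw [hx]
    simpa using isIntegral_algebraMap (R := ℤ) (A := K) (x := (d : ℤ))
  obtain ⟨y, rfl⟩ : ∃ y : 𝓞 K, (y : K) = x := ⟨⟨x, hint⟩, rfl⟩
  obtain ⟨m, hm⟩ := exists_trace_sq_sub_four_mul_norm hK y
  have hq := congrArg (algebraMap (𝓞 K) K) (sq_eq_trace_mul_sub_norm hK y)
  simp only [map_pow, map_sub, map_mul, map_intCast, hx] at hq
  rcases eq_or_ne (Algebra.trace ℤ (𝓞 K) y) 0 with ht | ht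
  · refine ⟨m, ?_⟩
    rw [ht] at hq hm
    have : ((d : ℤ) : K) = ((-Algebra.norm ℤ y : ℤ) : K) := by
      push_cast
      rw [hq]; simp
    have := Int.cast_injective this
    rw [← hm, this]; ring
  · exfalso
    have ht' : (Algebra.trace ℤ (𝓞 K) y : K) ≠ 0 := by exact_mod_cast ht
    set r : ℚ := ((d : ℚ) + Algebra.norm ℤ y) / Algebra.trace ℤ (𝓞 K) y with hr
    have hyr : (y : K) = r := by
      rw [hr]; push_cast
      rw [eq_div_iff ht']
      linear_combination -hq
    have hrd : r * r = (d : ℚ) := by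
      rw [hyr, ← Rat.cast_pow] at hx
      rw [← sq]
      exact_mod_cast hx
    obtain ⟨e, he⟩ := Rat.isSquare_natCast_iff.1 ⟨r, hrd.symm⟩
    have := Nat.isUnit_iff.1 (hd e (he ▸ dvd_rfl))
    subst this
    omega

end QuadraticNumberField

section FieldClass

theorem IsRealQuadratic.numberField {K : IntermediateField ℚ ℂ} (hK : IsRealQuadratic K) :
    NumberField K :=
  have : FiniteDimensional ℚ K := FiniteDimensional.of_finrank_pos (by rw [hK.1]; norm_num)
  ⟨⟩

theorem intDisc_eq_discr (K : IntermediateField ℚ ℂ) [h : NumberField K] : intDisc K = discr K := by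
  rw [intDisc, dif_pos h.to_finiteDimensional]

theorem clPlusCard_eq (K : IntermediateField ℚ ℂ) [h : NumberField K] :
    clPlusCard K = Nat.card (narrowClassGroup K) := by
  rw [clPlusCard, dif_pos h.to_finiteDimensional]

theorem IsRealQuadratic.intDisc_pos {K : IntermediateField ℚ ℂ} (hK : IsRealQuadratic K) :
    0 < intDisc K := by
  have := hK.numberField
  obtain ⟨ρ, -⟩ := Nat.card_eq_two_iff.1 hK.2
  rw [intDisc_eq_discr]
  exact discr_pos_of_realEmbedding hK.1 ρ

theorem IsRealQuadratic.le_of_intDisc_eq {K L : IntermediateField ℚ ℂ} (hK : IsRealQuadratic K)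
    (hL : IsRealQuadratic L) (h : intDisc K = intDisc L) : K ≤ L := by
  have := hK.numberField
  have := hL.numberField
  rw [intDisc_eq_discr, intDisc_eq_discr] at h
  obtain ⟨δ, hδ, hspan⟩ := exists_sq_eq_discr hK.1
  obtain ⟨η, hη, -⟩ := exists_sq_eq_discr hL.1
  have hsq : (δ : ℂ) ^ 2 = (η : ℂ) ^ 2 := by
    have h1 := congrArg (algebraMap K ℂ) hδ
    have h2 := congrArg (algebraMap L ℂ) hη
    rw [map_pow, map_intCast] at h1 h2
    rw [h, ← h2] at h1
    exact h1
  have hδL : (δ : ℂ) ∈ L := by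
    rcases sq_eq_sq_iff_eq_or_eq_neg.1 hsq with h | h
    · exact h ▸ η.2
    · exact h ▸ neg_mem η.2
  intro z hz
  obtain ⟨a, b, hab⟩ := hspan ⟨z, hz⟩
  have h3 : z = (a : ℂ) + (b : ℂ) * (δ : ℂ) := by
    have := congrArg (algebraMap K ℂ) hab
    rw [map_add, map_mul, map_ratCast, map_ratCast] at this
    exact this
  rw [h3]
  exact add_mem (SubfieldClass.ratCast_mem L a) (mul_mem (SubfieldClass.ratCast_mem L b) hδL)

theorem IsRealQuadratic.eq_of_intDisc_eq {K L : IntermediateField ℚ ℂ} (hK : IsRealQuadratic K)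
    (hL : IsRealQuadratic L) (h : intDisc K = intDisc L) : K = L :=
  le_antisymm (hK.le_of_intDisc_eq hL h) (hL.le_of_intDisc_eq hK h.symm)

theorem IsRealQuadratic.of_algEquiv {K L : IntermediateField ℚ ℂ} (hK : IsRealQuadratic K)
    (e : K ≃ₐ[ℚ] L) : IsRealQuadratic L := by
  refine ⟨by rw [← e.toLinearEquiv.finrank_eq, hK.1], ?_⟩
  rw [← hK.2]
  exact Nat.card_congr ⟨fun ρ => ρ.comp (e : K →+* L), fun ρ => ρ.comp (e.symm : L →+* K),
    fun ρ => by ext; simp, fun ρ => by ext; simp⟩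

open Polynomial IntermediateField in
theorem exists_isRealQuadratic {d : ℕ} (hd : Squarefree d) (hd1 : 1 < d) :
    ∃ K : IntermediateField ℚ ℂ, IsRealQuadratic K ∧ ∃ x : K, x ^ 2 = d := by
  set s : ℂ := ((Real.sqrt d : ℝ) : ℂ) with hs
  have hs2 : s ^ 2 = d := by
    rw [hs, ← Complex.ofReal_pow, Real.sq_sqrt (Nat.cast_nonneg d), Complex.ofReal_natCast]
  have hmonic : (X ^ 2 - C (d : ℚ)).Monic := monic_X_pow_sub_C _ two_ne_zero
  have hirr : Irreducible (X ^ 2 - C (d : ℚ)) := by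
    refine X_pow_sub_C_irreducible_of_prime Nat.prime_two fun r hr => ?_
    obtain ⟨e, he⟩ := Rat.isSquare_natCast_iff.1 ⟨r, by rw [← hr, sq]⟩
    have := Nat.isUnit_iff.1 (hd e (he ▸ dvd_rfl))
    subst this
    omega
  have hmin : minpoly ℚ s = X ^ 2 - C (d : ℚ) :=
    (minpoly.eq_of_irreducible_of_monic hirr (by simp [hs2]) hmonic).symm
  have hint : IsIntegral ℚ s := ⟨_, hmonic, by simp [hs2]⟩
  have hdeg : (minpoly ℚ s).natDegree = 2 := by rw [hmin, natDegree_X_pow_sub_C]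
  refine ⟨ℚ⟮s⟯, ⟨by rw [adjoin.finrank hint, hdeg], ?_⟩, AdjoinSimple.gen ℚ s, ?_⟩
  · have hsplit : ((minpoly ℚ s).map (algebraMap ℚ ℝ)).Splits := by
      have : (minpoly ℚ s).map (algebraMap ℚ ℝ) =
          (X - C (Real.sqrt d)) * (X + C (Real.sqrt d)) := by
        have hC : C (Real.sqrt d) ^ 2 = (d : ℝ[X]) := by
          rw [← C_pow, Real.sq_sqrt (Nat.cast_nonneg d), C_eq_natCast]
        rw [hmin]
        simp only [Polynomial.map_sub, Polynomial.map_pow, map_X, map_natCast,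
          Polynomial.map_natCast]
        linear_combination hC
      rw [this]
      exact (Splits.X_sub_C _).mul (Splits.X_add_C _)
    have := adjoin.finiteDimensional hint
    have h := card_algHom_adjoin_integral ℚ (K := ℝ) hint (minpoly.irreducible hint).separable hsplit
    rw [hdeg] at h
    rw [← h]
    exact Nat.card_congr (RingHom.equivRatAlgHom _ _)
  · apply Subtype.ext
    simpa using hs2

/-- Every squarefree `d > 1` is, up to squares, the discriminant of the chosen representative of a
class of real quadratic fields. -/
theorem exists_fieldClass {d : ℕ} (hd : Squarefree d) (hd1 : 1 < d) :
    ∃ c : FieldClass, IsRealQuadratic c.out ∧ ∃ m : ℤ, 4 * (d : ℤ) = m ^ 2 * intDisc c.out := by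
  obtain ⟨K, hK, x, hx⟩ := exists_isRealQuadratic hd hd1
  let c : FieldClass := Quotient.mk isoSetoid K
  obtain ⟨e⟩ : Nonempty (c.out ≃ₐ[ℚ] K) := @Quotient.exact _ isoSetoid _ _ (Quotient.out_eq c)
  have hc := hK.of_algEquiv e.symm
  have := hc.numberField
  refine ⟨c, hc, ?_⟩
  rw [intDisc_eq_discr]
  exact exists_four_mul_eq_sq_mul_discr hc.1 hd hd1 (x := e.symm x) (by rw [← map_pow, hx, map_natCast])

theorem intDisc_out_toNat_injective (P : IntermediateField ℚ ℂ → Prop)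
    (hP : ∀ K, P K → IsRealQuadratic K) :
    Function.Injective fun c : {c : FieldClass // P c.out} => (intDisc c.1.out).toNat := by
  rintro ⟨c, hc⟩ ⟨c', hc'⟩ h
  have h1 := (hP _ hc).intDisc_pos
  have h2 := (hP _ hc').intDisc_pos
  have h3 : intDisc c.out = intDisc c'.out := by
    simp only at h
    omega
  exact Subtype.ext (Quotient.out_injective ((hP _ hc).eq_of_intDisc_eq (hP _ hc') h3))

theorem toNat_intDisc_lt {K : IntermediateField ℚ ℂ} (hK : IsRealQuadratic K) {X : ℝ}
    (hX : (intDisc K : ℝ) < X) : (intDisc K).toNat < ⌈X⌉₊ := by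
  rw [Nat.lt_ceil]
  have h : (((intDisc K).toNat : ℤ) : ℝ) = intDisc K := by
    rw [Int.toNat_of_nonneg hK.intDisc_pos.le]
  rw [Int.cast_natCast] at h
  rwa [h]

theorem classCount_narrow_le {P : ℕ} (hP : P ≠ 0)
    (hcop : ∀ n : ℕ, (∀ p : ℕ, p.Prime → p % 4 = 3 → ¬ p ∣ n) → P.Coprime n) (X : ℝ) :
    classCount (fun K => IsRealQuadratic K ∧ (intDisc K : ℝ) < X ∧ clPlusCard K = clCard K) ≤
      P.totient * (⌈X⌉₊ / P + 1) := by
  refine le_trans ?_ (Nat.Ico_filter_coprime_le 0 ⌈X⌉₊ hP)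
  rw [classCount, ← Nat.card_eq_finsetCard]
  refine Nat.card_le_card_of_injective (fun c => ⟨(intDisc c.1.out).toNat, ?_⟩) fun c c' h =>
    intDisc_out_toNat_injective
      (fun K => IsRealQuadratic K ∧ (intDisc K : ℝ) < X ∧ clPlusCard K = clCard K)
      (fun K hK => hK.1) (congrArg Subtype.val h)
  obtain ⟨c, hc, hX, hcl⟩ := c
  have hlt := toNat_intDisc_lt hc hX
  simp only [Finset.mem_filter, Finset.mem_Ico, zero_le, zero_add, true_and]
  refine ⟨hlt, hcop _ fun p hp hp4 hdvd => ?_⟩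
  have := hc.numberField
  rw [clPlusCard_eq, clCard] at hcl
  refine not_dvd_discr_of_card_eq hc.1 hc.2 hcl hp hp4 ?_
  have h2 := Int.natCast_dvd_natCast.2 hdvd
  rw [Int.toNat_of_nonneg hc.intDisc_pos.le, intDisc_eq_discr] at h2
  exact h2

theorem finite_realQuadratic_intDisc_lt (X : ℝ) :
    Finite {c : FieldClass // IsRealQuadratic c.out ∧ (intDisc c.out : ℝ) < X} := by
  refine Finite.of_injective (β := Fin ⌈X⌉₊)
    (fun c => ⟨(intDisc c.1.out).toNat, toNat_intDisc_lt c.2.1 c.2.2⟩) fun c c' h =>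
    intDisc_out_toNat_injective (fun K => IsRealQuadratic K ∧ (intDisc K : ℝ) < X)
      (fun K hK => hK.1) (congrArg Fin.val h)

theorem Squarefree.eq_of_mul_sq_eq {a b x y : ℕ} (ha : Squarefree a) (hb : Squarefree b)
    (hx : x ≠ 0) (hy : y ≠ 0) (h : a * x ^ 2 = b * y ^ 2) : a = b := by
  refine Nat.eq_of_factorization_eq ha.ne_zero hb.ne_zero fun p => ?_
  have h1 := congrArg (fun n => n.factorization p) h
  simp only [Nat.factorization_mul ha.ne_zero (pow_ne_zero 2 hx),
    Nat.factorization_mul hb.ne_zero (pow_ne_zero 2 hy), Nat.factorization_pow,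
    Finsupp.add_apply, Finsupp.smul_apply, smul_eq_mul] at h1
  have h2 := ha.natFactorization_le_one p
  have h3 := hb.natFactorization_le_one p
  omega

theorem card_squarefree_le_classCount {N : ℕ} {X : ℝ} (hX : 4 * (N : ℝ) < X) :
    ((Finset.Ioc 0 N).filter Squarefree).card ≤
      classCount (fun K => IsRealQuadratic K ∧ (intDisc K : ℝ) < X) + 1 := by
  rw [← Nat.sub_le_iff_le_add]
  refine le_trans (Finset.pred_card_le_card_erase (a := 1)) ?_
  rw [classCount, ← Nat.card_eq_finsetCard]
  have hmem : ∀ d ∈ ((Finset.Ioc 0 N).filter Squarefree).erase 1,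
      Squarefree d ∧ 1 < d ∧ d ≤ N := by
    intro d hd
    simp only [Finset.mem_erase, Finset.mem_filter, Finset.mem_Ioc] at hd
    exact ⟨hd.2.2, by omega, hd.2.1.2⟩
  choose! c hc m hm using fun d hd => exists_fieldClass (hmem d hd).1 (hmem d hd).2.1
  have hm0 : ∀ d ∈ ((Finset.Ioc 0 N).filter Squarefree).erase 1, m d ≠ 0 := by
    intro d hd h0
    have h1 := hm d hd
    have h2 := (hmem d hd).2.1
    rw [h0] at h1
    omega
  have := finite_realQuadratic_intDisc_lt X
  refine Nat.card_le_card_of_injective (fun d => ⟨c d.1, hc d.1 d.2, ?_⟩) ?_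
  · obtain ⟨d, hd⟩ := d
    have h1 := hm d hd
    have h2 := (hc d hd).intDisc_pos
    have h3 : 1 ≤ m d ^ 2 := Int.add_one_le_iff.2 (sq_pos_of_ne_zero (hm0 d hd))
    have h4 : intDisc (c d).out ≤ 4 * (N : ℤ) := by
      have := (hmem d hd).2.2
      nlinarith
    have h5 : (intDisc (c d).out : ℝ) ≤ 4 * (N : ℝ) := by exact_mod_cast h4
    exact h5.trans_lt hX
  · rintro ⟨d, hd⟩ ⟨d', hd'⟩ h
    have hcc : c d = c d' := congrArg Subtype.val h
    have h1 := hm d hd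
    have h2 := hm d' hd'
    rw [← hcc] at h2
    refine Subtype.ext ((hmem d hd).1.eq_of_mul_sq_eq (hmem d' hd').1
      (Int.natAbs_ne_zero.2 (hm0 d' hd')) (Int.natAbs_ne_zero.2 (hm0 d hd)) ?_)
    zify
    rw [sq_abs, sq_abs]
    have h4 : (4 : ℤ) * (d * m d' ^ 2) = 4 * (d' * m d ^ 2) := by
      linear_combination m d' ^ 2 * h1 - m d ^ 2 * h2
    exact mul_left_cancel₀ four_ne_zero h4

end FieldClass

/-- When real quadratic fields are ordered by discriminant, a density of
`100%` of them satisfy `Cl(F) ≠ Cl⁺(F)`. -/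
theorem real_quadratic_narrow_ne_class_group :
    Filter.Tendsto (fun X : ℝ =>
      (classCount (fun K => IsRealQuadratic K ∧ (intDisc K : ℝ) < X ∧ clPlusCard K = clCard K) : ℝ) /
      (classCount (fun K => IsRealQuadratic K ∧ (intDisc K : ℝ) < X) : ℝ))
      Filter.atTop (nhds 0) := by
  rw [Metric.tendsto_atTop]
  intro ε hε
  obtain ⟨P, hP0, hP, hcop⟩ := exists_totient_le_mul (ε := ε / 256) (by positivity)
  refine ⟨P + 128, fun X hX => ?_⟩
  have hPpos : (0 : ℝ) < P := by exact_mod_cast Nat.pos_of_ne_zero hP0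
  have hX0 : 0 < X := by linarith
  have hnum : (classCount (fun K => IsRealQuadratic K ∧ (intDisc K : ℝ) < X ∧
      clPlusCard K = clCard K) : ℝ) ≤ ε / 128 * X := by
    have h1 : (classCount (fun K => IsRealQuadratic K ∧ (intDisc K : ℝ) < X ∧
        clPlusCard K = clCard K) : ℝ) ≤ P.totient * ((⌈X⌉₊ / P : ℕ) + 1) := by
      exact_mod_cast classCount_narrow_le hP0 hcop X
    have h2 : ((⌈X⌉₊ / P : ℕ) : ℝ) ≤ (X + 1) / P :=
      Nat.cast_div_le.trans (div_le_div_of_nonneg_right (Nat.ceil_lt_add_one hX0.le).le hPpos.le)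
    calc _ ≤ (P.totient : ℝ) * ((⌈X⌉₊ / P : ℕ) + 1) := h1
      _ ≤ ε / 256 * P * ((X + 1) / P + 1) := by gcongr
      _ = ε / 256 * (X + 1 + P) := by field_simp
      _ ≤ ε / 128 * X := by nlinarith
  have hden : X / 64 ≤ (classCount (fun K => IsRealQuadratic K ∧ (intDisc K : ℝ) < X) : ℝ) := by
    have hfloor : (⌊X / 8⌋₊ : ℝ) ≤ X / 8 := Nat.floor_le (by positivity)
    have h1 : (((Finset.Ioc 0 ⌊X / 8⌋₊).filter Squarefree).card : ℝ) ≤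
        classCount (fun K => IsRealQuadratic K ∧ (intDisc K : ℝ) < X) + 1 := by
      exact_mod_cast card_squarefree_le_classCount (N := ⌊X / 8⌋₊) (X := X) (by linarith)
    have h2 := le_four_mul_card_squarefree ⌊X / 8⌋₊
    have h3 := Nat.lt_floor_add_one (X / 8)
    linarith
  have hdpos := (by positivity : 0 < X / 64).trans_le hden
  rw [Real.dist_0_eq_abs, abs_of_nonneg (by positivity), div_lt_iff₀ hdpos]
  nlinarith
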